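/- Every local martingale M = (M_t)_{t ∈ ℝ₊} with respect to 𝔽 has a unique (up to indistinguishability) decomposition M = M′ + M″ into the sum of two local martingales with respect to 𝔽, where M′ is adapted with respect to the smallest filtration making γ a stopping time (i.e. the single jump filtration 𝔽(γ, σ{γ}) generated by γ and the σ-field σ{γ}), and M″ vanishes on the set {t < γ} and satisfies E(M″_0) = 0. -/

import Mathlib

open MeasureTheory Filter Set Topology
open scoped ENNReal NNReal Classical

noncomputable section

namespace SingleJump

variable {Ω : Type*}

/-- The event `{γ > t}`. -/
def jumpSet (γ : Ω → ℝ≥0∞) (t : ℝ≥0) : Set Ω := {ω | (t : ℝ≥0∞) < γ ω}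

/-- The collection `𝒻_t` of the single jump filtration generated by `γ` and the σ-field `m`:
`A ∈ 𝒻_t` iff `A` is `m`-measurable and `A ∩ {γ > t}` is either `∅` or `{γ > t}`. -/
def jumpColl (m : MeasurableSpace Ω) (γ : Ω → ℝ≥0∞) (t : ℝ≥0) : Set (Set Ω) :=
  {A | MeasurableSet[m] A ∧ (A ∩ jumpSet γ t = ∅ ∨ A ∩ jumpSet γ t = jumpSet γ t)}

/-- `𝒻_t` as a σ-field (the collection `jumpColl` generates itself, see Proposition 1(i)). -/
def jumpσ (m : MeasurableSpace Ω) (γ : Ω → ℝ≥0∞) (t : ℝ≥0) : MeasurableSpace Ω :=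
  MeasurableSpace.generateFrom (jumpColl m γ t)

/-- `𝒻_∞ = σ(⋃_{t ∈ ℝ₊} 𝒻_t)`. -/
def jumpσInf (m : MeasurableSpace Ω) (γ : Ω → ℝ≥0∞) : MeasurableSpace Ω :=
  ⨆ t : ℝ≥0, jumpσ m γ t

/-- A real function on `ℝ≥0` is càdlàg: right-continuous everywhere, finite left limits. -/
def Cadlag (f : ℝ≥0 → ℝ) : Prop :=
  (∀ t, ContinuousWithinAt f (Ici t) t) ∧
    ∀ t : ℝ≥0, 0 < t → ∃ c : ℝ, Tendsto f (𝓝[<] t) (𝓝 c)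

/-- The filter of times `t ∈ ℝ≥0` with `t ↑ a` strictly from the left (this is `atTop`
when `a = ∞`). -/
def leftF (a : ℝ≥0∞) : Filter ℝ≥0 := Filter.comap (fun t : ℝ≥0 => (t : ℝ≥0∞)) (𝓝[<] a)

/-- Total variation of `f` over `[0,∞)`, including `|f 0|` (the paper's convention `Var`). -/
def totalVar (f : ℝ≥0 → ℝ) : ℝ≥0∞ := (‖f 0‖₊ : ℝ≥0∞) + eVariationOn f Set.univ

/-- The process `M` stopped at the (possibly infinite) random time `T`. -/
def stopped (M : ℝ≥0 → Ω → ℝ) (T : Ω → ℝ≥0∞) : ℝ≥0 → Ω → ℝ :=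
  fun t ω => M (((t : ℝ≥0∞) ⊓ T ω).toNNReal) ω

section WithMeasurableSpace

variable [m : MeasurableSpace Ω]

/-- `Ḡ(t) = 1 - G(t) = P(γ > t)`. -/
def Gbar (μ : Measure Ω) (γ : Ω → ℝ≥0∞) (t : ℝ≥0) : ℝ :=
  (μ {ω | (t : ℝ≥0∞) < γ ω}).toReal

/-- `Ḡ(t-) = P(γ ≥ t)`, the left-hand limit of `Ḡ` at `t`. -/
def GbarLeft (μ : Measure Ω) (γ : Ω → ℝ≥0∞) (t : ℝ≥0) : ℝ :=
  (μ {ω | (t : ℝ≥0∞) ≤ γ ω}).toReal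

/-- `t_G = sup {t ∈ ℝ₊ : G(t) < 1}`, the right endpoint of the law of `γ`. -/
def tG (μ : Measure Ω) (γ : Ω → ℝ≥0∞) : ℝ≥0∞ :=
  sSup ((fun t : ℝ≥0 => (t : ℝ≥0∞)) '' {t : ℝ≥0 | μ {ω | γ ω ≤ (t : ℝ≥0∞)} < 1})

/-- `𝒯 = {t ∈ ℝ₊ : P(γ ≥ t) > 0}`. -/
def TT (μ : Measure Ω) (γ : Ω → ℝ≥0∞) : Set ℝ≥0 :=
  {t | 0 < μ {ω | (t : ℝ≥0∞) ≤ γ ω}}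

/-- Case A: `P(γ = t_G < ∞) = 0`. -/
def CaseA (μ : Measure Ω) (γ : Ω → ℝ≥0∞) : Prop :=
  μ {ω | γ ω = tG μ γ ∧ tG μ γ < ⊤} = 0

/-- Case B: `P(γ = t_G < ∞) > 0`. -/
def CaseB (μ : Measure Ω) (γ : Ω → ℝ≥0∞) : Prop :=
  0 < μ {ω | γ ω = tG μ γ ∧ tG μ γ < ⊤}

/-- `z ∈ L¹_loc(dG)` : `z` is Borel and `∫_{[0,t]} |z(s)| dG(s) < ∞` for every `t ∈ 𝒯`,
where `dG` is the law of `γ` (a measure on `[0,∞]`). -/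
def MemL1loc (μ : Measure Ω) (γ : Ω → ℝ≥0∞) (z : ℝ≥0 → ℝ) : Prop :=
  Measurable z ∧ ∀ t ∈ TT μ γ,
    IntegrableOn (fun x : ℝ≥0∞ => z x.toNNReal) (Icc 0 (t : ℝ≥0∞)) (μ.map γ)

/-- `F loc≪ G` with density `z = dF/dG` : `F(t) = F(0) + ∫_(0,t] z(s) dG(s)` for `t < t_G`. -/
def LocAC (μ : Measure Ω) (γ : Ω → ℝ≥0∞) (F z : ℝ≥0 → ℝ) : Prop :=
  MemL1loc μ γ z ∧ ∀ t : ℝ≥0, (t : ℝ≥0∞) < tG μ γ →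
    F t = F 0 + ∫ x in Ioc (0 : ℝ≥0∞) (t : ℝ≥0∞), z x.toNNReal ∂(μ.map γ)

/-- Condition M for the pair `(F, H)`. -/
def CondM (μ : Measure Ω) (γ : Ω → ℝ≥0∞) (F H : ℝ≥0 → ℝ) : Prop :=
  (∃ z, LocAC μ γ F z) ∧ MemL1loc μ γ H ∧
  (∀ t : ℝ≥0, (t : ℝ≥0∞) < tG μ γ →
    F t * Gbar μ γ t + ∫ x in Ioc (0 : ℝ≥0∞) (t : ℝ≥0∞), H x.toNNReal ∂(μ.map γ)
      = F 0 * Gbar μ γ 0) ∧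
  (CaseB μ γ → Tendsto F (leftF (tG μ γ)) (𝓝 (H (tG μ γ).toNNReal)))

/-- A stopping time of the single jump filtration: `{T ≤ t} ∈ 𝒻_t` for all `t ∈ ℝ₊`. -/
def IsSJStoppingTime (γ : Ω → ℝ≥0∞) (T : Ω → ℝ≥0∞) : Prop :=
  ∀ t : ℝ≥0, {ω | T ω ≤ (t : ℝ≥0∞)} ∈ jumpColl m γ t

/-- The martingale property on a set `S` of times, w.r.t. the single jump filtration. -/
def MartingaleOn (μ : Measure Ω) (γ : Ω → ℝ≥0∞) (M : ℝ≥0 → Ω → ℝ) (S : Set ℝ≥0) : Prop :=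
  (∀ t ∈ S, Measurable[jumpσ m γ t] (M t)) ∧ (∀ t ∈ S, Integrable (M t) μ) ∧
    ∀ s ∈ S, ∀ t ∈ S, s ≤ t → μ[M t|jumpσ m γ s] =ᵐ[μ] M s

/-- A uniformly integrable martingale w.r.t. the single jump filtration. -/
def UIMartingale (μ : Measure Ω) (γ : Ω → ℝ≥0∞) (M : ℝ≥0 → Ω → ℝ) : Prop :=
  MartingaleOn μ γ M Set.univ ∧ UniformIntegrable M 1 μ

/-- A local martingale w.r.t. the single jump filtration: adapted, a.s. càdlàg paths, and
there are stopping times `T n ↑ ∞` a.s. with each stopped process a UI martingale. -/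
def LocalMartingale (μ : Measure Ω) (γ : Ω → ℝ≥0∞) (M : ℝ≥0 → Ω → ℝ) : Prop :=
  (∀ t : ℝ≥0, Measurable[jumpσ m γ t] (M t)) ∧
  (∀ᵐ ω ∂μ, Cadlag fun t => M t ω) ∧
  ∃ T : ℕ → Ω → ℝ≥0∞,
    (∀ n, IsSJStoppingTime γ (T n)) ∧
    (∀ᵐ ω ∂μ, Monotone (fun n => T n ω) ∧ Tendsto (fun n => T n ω) atTop (𝓝 (⊤ : ℝ≥0∞))) ∧
    ∀ n, UIMartingale μ γ (stopped M (T n))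

/-- `E[L' | γ] = 0` for a (possibly only locally integrable) random variable `L'`. -/
def CondZeroGivenGamma (μ : Measure Ω) (γ : Ω → ℝ≥0∞) (L' : Ω → ℝ) : Prop :=
  ∀ B : Set ℝ≥0∞, MeasurableSet B → IntegrableOn L' (γ ⁻¹' B) μ →
    ∫ ω in γ ⁻¹' B, L' ω ∂μ = 0


set_option linter.unusedSectionVars false

theorem measurableSet_jumpσ (m0 : MeasurableSpace Ω) (γ : Ω → ℝ≥0∞) (t : ℝ≥0) (A : Set Ω) :
    MeasurableSet[jumpσ m0 γ t] A ↔ A ∈ jumpColl m0 γ t := by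
  constructor
  · intro h
    induction A, h using MeasurableSpace.generateFrom_induction with
    | hC t ht _ => exact ht
    | empty => exact ⟨MeasurableSet.empty, Or.inl (by simp)⟩
    | compl A _ ih =>
      refine ⟨ih.1.compl, ?_⟩
      rcases ih.2 with h | h
      · right; ext ω; have := Set.ext_iff.1 h ω; simp at this ⊢; tauto
      · left; ext ω; have := Set.ext_iff.1 h ω; simp at this ⊢; tauto
    | iUnion f _ ih =>
      refine ⟨MeasurableSet.iUnion fun i => (ih i).1, ?_⟩
      by_cases hh : ∃ i, f i ∩ jumpSet γ t = jumpSet γ t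
      · obtain ⟨i, hi⟩ := hh
        right
        apply Set.Subset.antisymm Set.inter_subset_right
        intro ω hω
        rw [← hi] at hω
        exact ⟨Set.mem_iUnion.2 ⟨i, hω.1⟩, hω.2⟩
      · left
        push Not at hh
        rw [Set.iUnion_inter]
        simp only [Set.iUnion_eq_empty]
        intro i
        exact (ih i).2.resolve_right (hh i)
  · intro h
    exact MeasurableSpace.measurableSet_generateFrom h

theorem jumpσ_le (m0 : MeasurableSpace Ω) (γ : Ω → ℝ≥0∞) (t : ℝ≥0) : jumpσ m0 γ t ≤ m0 := by
  intro A hA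
  exact ((measurableSet_jumpσ m0 γ t A).1 hA).1

theorem jumpσ_mono_left {m0 m1 : MeasurableSpace Ω} (h : m0 ≤ m1) (γ : Ω → ℝ≥0∞) (t : ℝ≥0) :
    jumpσ m0 γ t ≤ jumpσ m1 γ t := by
  intro A hA
  rw [measurableSet_jumpσ] at hA ⊢
  exact ⟨h _ hA.1, hA.2⟩

theorem jumpσ_mono (m0 : MeasurableSpace Ω) (γ : Ω → ℝ≥0∞) {s t : ℝ≥0} (h : s ≤ t) :
    jumpσ m0 γ s ≤ jumpσ m0 γ t := by
  intro A hA
  rw [measurableSet_jumpσ] at hA ⊢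
  have hsub : jumpSet γ t ⊆ jumpSet γ s := by
    intro ω hω
    simp only [jumpSet, Set.mem_ofPred_eq] at hω ⊢
    exact lt_of_le_of_lt (by exact_mod_cast h) hω
  refine ⟨hA.1, ?_⟩
  rcases hA.2 with h | h
  · left
    apply Set.eq_empty_of_subset_empty
    rw [← h]
    exact Set.inter_subset_inter_right _ hsub
  · right
    apply Set.inter_eq_right.2
    exact hsub.trans (Set.inter_eq_right.1 h)

theorem measurable_jumpσ_of (m0 : MeasurableSpace Ω) (γ : Ω → ℝ≥0∞) (t : ℝ≥0) (f : Ω → ℝ)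
    (hf : Measurable[m0] f) (c : ℝ) (hc : ∀ ω, (t : ℝ≥0∞) < γ ω → f ω = c) :
    Measurable[jumpσ m0 γ t] f := by
  intro S hS
  rw [measurableSet_jumpσ]
  refine ⟨hf hS, ?_⟩
  by_cases h : c ∈ S
  · right
    apply Set.inter_eq_right.2
    intro ω hω
    simp only [Set.mem_preimage, hc ω hω, h]
  · left
    ext ω
    simp only [Set.mem_inter_iff, Set.mem_preimage, Set.mem_empty_iff_false, iff_false, not_and]
    intro h1 h2
    rw [hc ω h2] at h1
    exact h h1

theorem const_of_measurable_jumpσ (m0 : MeasurableSpace Ω) (γ : Ω → ℝ≥0∞) (t : ℝ≥0) (f : Ω → ℝ)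
    (hf : Measurable[jumpσ m0 γ t] f) (ω ω' : Ω) (h : (t : ℝ≥0∞) < γ ω) (h' : (t : ℝ≥0∞) < γ ω') :
    f ω = f ω' := by
  have h1 : MeasurableSet[jumpσ m0 γ t] (f ⁻¹' {f ω'}) := hf (measurableSet_singleton _)
  rw [measurableSet_jumpσ] at h1
  rcases h1.2 with h2 | h2
  · have : ω' ∈ (∅ : Set Ω) := by
      rw [← h2]
      exact ⟨rfl, h'⟩
    exact this.elim
  · have : ω ∈ f ⁻¹' {f ω'} ∩ jumpSet γ t := by
      rw [h2]; exact h
    exact this.1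

theorem exists_const (m0 : MeasurableSpace Ω) (γ : Ω → ℝ≥0∞) (M : ℝ≥0 → Ω → ℝ)
    (hM : ∀ t, Measurable[jumpσ m0 γ t] (M t)) :
    ∃ F : ℝ≥0 → ℝ, ∀ (t : ℝ≥0) ω, (t : ℝ≥0∞) < γ ω → M t ω = F t := by
  have : ∀ t : ℝ≥0, ∃ c : ℝ, ∀ ω, (t : ℝ≥0∞) < γ ω → M t ω = c := by
    intro t
    by_cases h : ∃ ω, (t : ℝ≥0∞) < γ ω
    · obtain ⟨ω, hω⟩ := h
      exact ⟨M t ω, fun ω' h' => const_of_measurable_jumpσ m0 γ t _ (hM t) ω' ω h' hω⟩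
    · exact ⟨0, fun ω hω => (h ⟨ω, hω⟩).elim⟩
  choose F hF using this
  exact ⟨F, hF⟩

/-- Structure of stopping times. -/
theorem stopping_structure (γ T : Ω → ℝ≥0∞) (hT : IsSJStoppingTime γ T) :
    ∃ r : ℝ≥0∞, ∀ ω, T ω ⊓ γ ω = r ⊓ γ ω := by
  set R : Set ℝ≥0∞ := {ρ | ∀ ω, ρ ⊓ γ ω ≤ T ω} with hR
  refine ⟨sSup R, fun ω => le_antisymm (le_inf ?_ inf_le_right) (le_inf ?_ inf_le_right)⟩
  · by_contra hcon
    push Not at hcon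
    obtain ⟨t, ht1, ht2⟩ := ENNReal.lt_iff_exists_nnreal_btwn.1 hcon
    have htT : (t : ℝ≥0∞) < T ω := ht2.trans_le inf_le_left
    have htγ : (t : ℝ≥0∞) < γ ω := ht2.trans_le inf_le_right
    have htR : (t : ℝ≥0∞) ∈ R := by
      intro ω'
      by_contra hc
      push Not at hc
      have h1 : T ω' < t := hc.trans_le inf_le_left
      have h2 : T ω' < γ ω' := hc.trans_le inf_le_right
      have hne : T ω' ≠ ⊤ := h1.ne_top
      have hu : ((T ω').toNNReal : ℝ≥0∞) = T ω' := ENNReal.coe_toNNReal hne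
      have h3 := (hT (T ω').toNNReal).2
      rw [hu] at h3
      rcases h3 with h3 | h3
      · have : ω' ∈ (∅ : Set Ω) := by
          rw [← h3]
          refine ⟨by simp, ?_⟩
          simpa [jumpSet, hu] using h2
        exact this.elim
      · have : ω ∈ {ω | T ω ≤ T ω'} ∩ jumpSet γ (T ω').toNNReal := by
          rw [h3]
          simp only [jumpSet, Set.mem_ofPred_eq, hu]
          exact h1.trans htγ
        exact absurd (lt_of_le_of_lt this.1 (h1.trans htT)) (lt_irrefl _)
    exact absurd (le_sSup htR) (not_le.2 ht1)
  · by_contra hcon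
    push Not at hcon
    obtain ⟨ρ, hρ, hρ2⟩ := lt_sSup_iff.1 (hcon.trans_le inf_le_left)
    exact absurd (hρ ω) (not_le.2 (lt_inf_iff.2 ⟨hρ2, hcon.trans_le inf_le_right⟩))

/-- The terminal value. -/
def Linf (X : ℝ≥0 → Ω → ℝ) (ω : Ω) : ℝ := limsup (fun k : ℕ => X (k : ℝ≥0) ω) atTop

theorem measurable_Linf (m0 : MeasurableSpace Ω) (X : ℝ≥0 → Ω → ℝ)
    (hX : ∀ t, Measurable[m0] (X t)) : Measurable[m0] (Linf X) :=
  Measurable.limsup fun k => hX k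

theorem Linf_eq (X : ℝ≥0 → Ω → ℝ) (ω : Ω) (g : ℝ≥0∞) (hg : g ≠ ⊤) (c : ℝ)
    (h : ∀ t : ℝ≥0, g ≤ t → X t ω = c) : Linf X ω = c := by
  apply Tendsto.limsup_eq
  apply tendsto_const_nhds.congr'
  filter_upwards [eventually_ge_atTop (⌈g.toNNReal⌉₊)] with k hk
  refine (h _ ?_).symm
  rw [← ENNReal.coe_toNNReal hg]
  exact_mod_cast Nat.ceil_le.1 hk

/-- A local martingale is a.s. constant after `γ`. -/
theorem const_after (μ : Measure Ω) [IsProbabilityMeasure μ] (γ : Ω → ℝ≥0∞)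
    (hγ : Measurable γ) (M : ℝ≥0 → Ω → ℝ) (hM : LocalMartingale μ γ M) :
    ∀ᵐ ω ∂μ, ∀ t : ℝ≥0, γ ω ≤ t → M t ω = Linf M ω := by
  obtain ⟨hmeas, hcad, T, hT, hTlim, hUI⟩ := hM
  have step1 : ∀ n (s t : ℝ≥0), s ≤ t → ∀ᵐ ω ∂μ, γ ω ≤ s →
      stopped M (T n) t ω = stopped M (T n) s ω := by
    intro n s t hst
    obtain ⟨⟨ha, hi, hc⟩, -⟩ := hUI n
    have hB : MeasurableSet {ω | γ ω ≤ (s : ℝ≥0∞)} := measurableSet_le hγ measurable_const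
    have h1 : ({ω | γ ω ≤ (s : ℝ≥0∞)}.indicator
        (stopped M (T n) t - stopped M (T n) s)) =ᵐ[μ] 0 := by
      apply Integrable.ae_eq_zero_of_forall_setIntegral_eq_zero
      · exact ((hi t trivial).sub (hi s trivial)).indicator hB
      · intro A hA _
        rw [setIntegral_indicator hB]
        have hAs : MeasurableSet[jumpσ m γ s] (A ∩ {ω | γ ω ≤ (s : ℝ≥0∞)}) := by
          rw [measurableSet_jumpσ]
          refine ⟨hA.inter hB, Or.inl ?_⟩
          ext ω
          simp [jumpSet]
        have e1 := setIntegral_condExp (jumpσ_le m γ s) (hi t trivial) hAs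
        have e2 : ∫ ω in A ∩ {ω | γ ω ≤ (s : ℝ≥0∞)}, (μ[stopped M (T n) t|jumpσ m γ s]) ω ∂μ
            = ∫ ω in A ∩ {ω | γ ω ≤ (s : ℝ≥0∞)}, stopped M (T n) s ω ∂μ :=
          integral_congr_ae (ae_restrict_of_ae (hc s trivial t trivial hst))
        simp only [Pi.sub_apply]
        rw [integral_sub (hi t trivial).integrableOn (hi s trivial).integrableOn, ← e1, e2, sub_self]
    filter_upwards [h1] with ω hω hle
    rw [Set.indicator_of_mem (by exact hle)] at hω
    simpa [sub_eq_zero] using hω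
  have step2 : ∀ s t : ℝ≥0, s ≤ t → ∀ᵐ ω ∂μ, γ ω ≤ s → M t ω = M s ω := by
    intro s t hst
    have := ae_all_iff.2 fun n => step1 n s t hst
    filter_upwards [this, hTlim] with ω h1 h2 hle
    have h3 : ∀ᶠ n in atTop, (t : ℝ≥0∞) < T n ω := h2.2.eventually (lt_mem_nhds ENNReal.coe_lt_top)
    obtain ⟨n, hn⟩ := h3.exists
    have h4 := h1 n hle
    simp only [stopped] at h4
    have hs' : (s : ℝ≥0∞) ≤ T n ω := le_trans (by exact_mod_cast hst) hn.le
    rwa [inf_eq_left.2 hn.le, inf_eq_left.2 hs', ENNReal.toNNReal_coe, ENNReal.toNNReal_coe] at h4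
  have step3 : ∀ᵐ ω ∂μ, ∀ p q : ℚ, p ≤ q → γ ω ≤ ((p : ℝ).toNNReal : ℝ≥0) →
      M (q : ℝ).toNNReal ω = M (p : ℝ).toNNReal ω := by
    rw [ae_all_iff]; intro p
    rw [ae_all_iff]; intro q
    by_cases hpq : p ≤ q
    · filter_upwards [step2 (p : ℝ).toNNReal (q : ℝ).toNNReal
        (Real.toNNReal_le_toNNReal (by exact_mod_cast hpq))] with ω h _ hle using h hle
    · exact Eventually.of_forall fun ω h => (hpq h).elim
  filter_upwards [step3, hcad] with ω h3 hc t ht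
  -- right-limit along rationals
  have key : ∀ u v : ℝ≥0, γ ω ≤ u → u ≤ v → M u ω = M v ω := by
    intro u v hu huv
    obtain ⟨p, hp1⟩ := exists_rat_gt (v : ℝ)
    have hconst : ∀ x : ℝ≥0, γ ω ≤ x → x ≤ v → M x ω = M (p : ℝ).toNNReal ω := by
      intro x hx hxv
      have hxp : (x : ℝ) < p := lt_of_le_of_lt (by exact_mod_cast hxv) hp1
      obtain ⟨a, -, ha, hlim⟩ := (Rat.denseRange_cast (𝕜 := ℝ)).exists_seq_strictAnti_tendsto_of_lt
        Rat.cast_strictMono.monotone hxp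
      have hlim' : Tendsto (fun n => ((a n : ℝ)).toNNReal) atTop (𝓝[Ici x] x) := by
        apply tendsto_nhdsWithin_iff.2
        constructor
        · have := (continuous_real_toNNReal.tendsto (x : ℝ)).comp hlim
          rwa [Real.toNNReal_coe] at this
        · refine Eventually.of_forall fun n => ?_
          exact NNReal.le_toNNReal_of_coe_le (ha n).1.le
      have h5 : Tendsto (fun n => M ((a n : ℝ)).toNNReal ω) atTop (𝓝 (M x ω)) :=
        (hc.1 x).tendsto.comp hlim'
      refine tendsto_nhds_unique h5 ?_
      apply tendsto_const_nhds.congr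
      intro n
      refine h3 (a n) p (by exact_mod_cast (ha n).2.le) (hx.trans ?_)
      exact_mod_cast NNReal.le_toNNReal_of_coe_le (ha n).1.le
    rw [hconst u hu huv, hconst v (hu.trans (by exact_mod_cast huv)) le_rfl]
  refine (Linf_eq M ω (t : ℝ≥0∞) ENNReal.coe_ne_top (M t ω) ?_).symm
  intro u hu
  exact (key t u ht (by exact_mod_cast hu)).symm

theorem le_iff_of_structure {T γ r : ℝ≥0∞} (h : T ⊓ γ = r ⊓ γ) : γ ≤ T ↔ γ ≤ r := by
  rw [← inf_eq_right, h, inf_eq_right]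

theorem inf_eq_of_structure {T γ r t : ℝ≥0∞} (h : T ⊓ γ = r ⊓ γ) (hlt : t ⊓ r < γ) :
    t ⊓ T = t ⊓ r := by
  rcases le_or_gt γ T with h1 | h1
  · have h2 := (le_iff_of_structure h).1 h1
    have h3 : t < γ := by
      rcases inf_lt_iff.1 hlt with h | h
      · exact h
      · exact absurd h2 (not_le.2 h)
    rw [inf_eq_left.2 (h3.le.trans h1), inf_eq_left.2 (h3.le.trans h2)]
  · have h2 : r < γ := by
      by_contra hc
      exact absurd ((le_iff_of_structure h).2 (not_lt.1 hc)) (not_le.2 h1)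
    rw [inf_eq_left.2 h1.le, inf_eq_left.2 h2.le] at h
    rw [h]

/-- Conditional expectation given `γ` of a locally integrable variable. -/
theorem exists_condGamma (μ : Measure Ω) [IsProbabilityMeasure μ] (γ : Ω → ℝ≥0∞)
    (hγ : Measurable γ) (L : Ω → ℝ) (hL : Measurable L) :
    ∃ h : ℝ≥0∞ → ℝ, Measurable h ∧ ∀ S : Set ℝ≥0∞, MeasurableSet S →
      IntegrableOn L (γ ⁻¹' S) μ → IntegrableOn (fun ω => h (γ ω)) (γ ⁻¹' S) μ ∧
        ∫ ω in γ ⁻¹' S, h (γ ω) ∂μ = ∫ ω in γ ⁻¹' S, L ω ∂μ := by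
  refine ⟨fun x => ∫ y, y ∂(ProbabilityTheory.condDistrib L γ μ x), ?_, ?_⟩
  · exact (StronglyMeasurable.integral_kernel stronglyMeasurable_id).measurable
  · intro S hS hVi
    have hS' : MeasurableSet (γ ⁻¹' S) := hγ hS
    let f : ℝ≥0∞ × ℝ → ℝ := fun p => S.indicator (fun _ => p.2) p.1
    have hf : Measurable f := by
      have : f = (Prod.fst ⁻¹' S).indicator Prod.snd := by
        ext p; simp [f, Set.indicator]
      rw [this]
      exact measurable_snd.indicator (measurable_fst hS)
    have hfi : Integrable (fun ω => f (γ ω, L ω)) μ := by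
      have : (fun ω => f (γ ω, L ω)) = (γ ⁻¹' S).indicator L := by
        ext ω; simp [f, Set.indicator]
      rw [this]
      exact (integrable_indicator_iff hS').2 hVi
    have key := ProbabilityTheory.condExp_prod_ae_eq_integral_condDistrib hγ hL.aemeasurable
      hf.stronglyMeasurable hfi
    have e : (fun ω => ∫ y, f (γ ω, y) ∂(ProbabilityTheory.condDistrib L γ μ (γ ω)))
        = (γ ⁻¹' S).indicator
          (fun ω => ∫ y, y ∂(ProbabilityTheory.condDistrib L γ μ (γ ω))) := by
      ext ω
      by_cases hω : γ ω ∈ S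
      · simp [f, Set.indicator, hω]
      · simp [f, Set.indicator, hω]
    rw [e] at key
    constructor
    · rw [← integrable_indicator_iff hS']
      exact integrable_condExp.congr key
    · rw [← integral_indicator hS', ← integral_congr_ae key, integral_condExp hγ.comap_le,
        ← integral_indicator hS']
      congr 1

theorem uiMartingale_jump (μ : Measure Ω) [IsProbabilityMeasure μ] (γ : Ω → ℝ≥0∞)
    (hγ : Measurable γ) (V : Ω → ℝ) (hV : Measurable V) (T : Ω → ℝ≥0∞) (r : ℝ≥0∞)
    (hr : ∀ ω, T ω ⊓ γ ω = r ⊓ γ ω)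
    (hVi : IntegrableOn V (γ ⁻¹' {x | x ≤ r ∧ x ≠ ⊤}) μ)
    (hzero : ∀ S : Set ℝ≥0∞, MeasurableSet S → S ⊆ {x | x ≤ r ∧ x ≠ ⊤} →
      ∫ ω in γ ⁻¹' S, V ω ∂μ = 0) :
    UIMartingale μ γ (stopped (fun (t : ℝ≥0) ω => if γ ω ≤ t then V ω else 0) T) := by
  have hBm : MeasurableSet {x : ℝ≥0∞ | x ≤ r ∧ x ≠ ⊤} :=
    measurableSet_Iic.inter (measurableSet_singleton _).compl
  set B : Set ℝ≥0∞ := {x | x ≤ r ∧ x ≠ ⊤} with hB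
  set g : Ω → ℝ := (γ ⁻¹' B).indicator V with hg
  have hgi : Integrable g μ := (integrable_indicator_iff (hγ hBm)).2 hVi
  have hst : ∀ t : ℝ≥0, stopped (fun (t : ℝ≥0) ω => if γ ω ≤ t then V ω else 0) T t
      = (γ ⁻¹' (B ∩ Iic (t : ℝ≥0∞))).indicator V := by
    intro t
    ext ω
    have hne : (t : ℝ≥0∞) ⊓ T ω ≠ ⊤ := (lt_of_le_of_lt inf_le_left ENNReal.coe_lt_top).ne
    simp only [stopped, ENNReal.coe_toNNReal hne, Set.indicator, le_inf_iff,
      le_iff_of_structure (hr ω), Set.mem_preimage, Set.mem_inter_iff, Set.mem_Iic, hB,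
      Set.mem_ofPred_eq]
    have : γ ω ≤ t → γ ω ≠ ⊤ := fun h => (lt_of_le_of_lt h ENNReal.coe_lt_top).ne
    congr 1
    apply propext
    tauto
  have hSm : ∀ t : ℝ≥0, MeasurableSet (B ∩ Iic (t : ℝ≥0∞)) := fun t => hBm.inter measurableSet_Iic
  have hmeas : ∀ t : ℝ≥0, Measurable[jumpσ m γ t]
      (stopped (fun (t : ℝ≥0) ω => if γ ω ≤ t then V ω else 0) T t) := by
    intro t
    rw [hst t]
    refine measurable_jumpσ_of m γ t _ (hV.indicator (hγ (hSm t))) 0 ?_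
    intro ω hω
    apply Set.indicator_of_notMem
    intro h
    exact absurd h.2 (not_le.2 hω)
  have hsti : ∀ t : ℝ≥0, Integrable
      (stopped (fun (t : ℝ≥0) ω => if γ ω ≤ t then V ω else 0) T t) μ := by
    intro t
    rw [hst t, integrable_indicator_iff (hγ (hSm t))]
    exact hVi.mono_set (Set.preimage_mono Set.inter_subset_left)
  have hce : ∀ t : ℝ≥0, stopped (fun (t : ℝ≥0) ω => if γ ω ≤ t then V ω else 0) T t
      =ᵐ[μ] μ[g|jumpσ m γ t] := by
    intro t
    refine ae_eq_condExp_of_forall_setIntegral_eq (jumpσ_le m γ t) hgi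
      (fun _ _ _ => (hsti t).integrableOn) ?_ (hmeas t).stronglyMeasurable.aestronglyMeasurable
    intro A hA _
    have hAm : MeasurableSet A := jumpσ_le m γ t _ hA
    rw [measurableSet_jumpσ] at hA
    have hdiff : ∀ ω, g ω = stopped (fun (t : ℝ≥0) ω => if γ ω ≤ t then V ω else 0) T t ω
        + (γ ⁻¹' (B ∩ Ioi (t : ℝ≥0∞))).indicator V ω := by
      intro ω
      rw [hst t]
      by_cases h1 : γ ω ∈ B
      · by_cases h2 : γ ω ≤ t
        · simp [hg, Set.indicator, h1, h2, not_lt.2 h2]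
        · simp [hg, Set.indicator, h1, h2, not_le.1 h2]
      · simp [hg, Set.indicator, h1]
    have hS2 : MeasurableSet (B ∩ Ioi (t : ℝ≥0∞)) := hBm.inter measurableSet_Ioi
    have hi2 : Integrable ((γ ⁻¹' (B ∩ Ioi (t : ℝ≥0∞))).indicator V) μ := by
      rw [integrable_indicator_iff (hγ hS2)]
      exact hVi.mono_set (Set.preimage_mono Set.inter_subset_left)
    simp_rw [hdiff]
    rw [integral_add (hsti t).integrableOn hi2.integrableOn, setIntegral_indicator (hγ hS2)]
    have hz : ∫ ω in A ∩ γ ⁻¹' (B ∩ Ioi (t : ℝ≥0∞)), V ω ∂μ = 0 := by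
      have hJ : γ ⁻¹' (B ∩ Ioi (t : ℝ≥0∞)) = jumpSet γ t ∩ γ ⁻¹' B := by
        ext ω; simp [jumpSet, and_comm]
      rw [hJ, ← Set.inter_assoc]
      rcases hA.2 with h | h
      · rw [h]; simp
      · rw [h, ← hJ]
        exact hzero _ hS2 Set.inter_subset_left
    rw [hz, add_zero]
  refine ⟨⟨fun t _ => hmeas t, fun t _ => hsti t, ?_⟩, ?_⟩
  · intro s _ t _ hst'
    calc μ[_|jumpσ m γ s] =ᵐ[μ] μ[μ[g|jumpσ m γ t]|jumpσ m γ s] := condExp_congr_ae (hce t)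
      _ =ᵐ[μ] μ[g|jumpσ m γ s] := condExp_condExp_of_le (jumpσ_mono m γ hst') (jumpσ_le m γ t)
      _ =ᵐ[μ] _ := (hce s).symm
  · exact (hgi.uniformIntegrable_condExp (fun t => jumpσ_le m γ t)).ae_eq fun t => (hce t).symm

theorem uiMartingale_sub (μ : Measure Ω) [IsProbabilityMeasure μ] (γ : Ω → ℝ≥0∞)
    (X Y Z : ℝ≥0 → Ω → ℝ) (hX : UIMartingale μ γ X) (hY : UIMartingale μ γ Y)
    (hZ : ∀ t, Measurable[jumpσ m γ t] (Z t)) (h : ∀ t, X t - Y t =ᵐ[μ] Z t) :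
    UIMartingale μ γ Z := by
  obtain ⟨⟨-, hXi, hXc⟩, hXu⟩ := hX
  obtain ⟨⟨-, hYi, hYc⟩, hYu⟩ := hY
  refine ⟨⟨fun t _ => hZ t, fun t _ => ((hXi t trivial).sub (hYi t trivial)).congr (h t), ?_⟩, ?_⟩
  · intro s _ t _ hst
    calc μ[Z t|jumpσ m γ s] =ᵐ[μ] μ[X t - Y t|jumpσ m γ s] := condExp_congr_ae (h t).symm
      _ =ᵐ[μ] μ[X t|jumpσ m γ s] - μ[Y t|jumpσ m γ s] :=
        condExp_sub (hXi t trivial) (hYi t trivial) _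
      _ =ᵐ[μ] X s - Y s := (hXc s trivial t trivial hst).sub (hYc s trivial t trivial hst)
      _ =ᵐ[μ] Z s := h s
  · obtain ⟨CX, hCX⟩ := hXu.2.2
    obtain ⟨CY, hCY⟩ := hYu.2.2
    have : UniformIntegrable (X - Y) 1 μ := by
      refine ⟨fun t => (hXu.1 t).sub (hYu.1 t), hXu.2.1.sub hYu.2.1 le_rfl hXu.1 hYu.1,
        CX + CY, fun t => ?_⟩
      refine (eLpNorm_sub_le (hXu.1 t) (hYu.1 t) le_rfl).trans ?_
      push_cast
      exact add_le_add (hCX t) (hCY t)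
    exact this.ae_eq h

theorem integrableOn_Linf (μ : Measure Ω) [IsProbabilityMeasure μ] (γ : Ω → ℝ≥0∞)
    (hγ : Measurable γ) (X : ℝ≥0 → Ω → ℝ) (hXm : ∀ t, Measurable (X t))
    (hc : ∀ᵐ ω ∂μ, ∀ t : ℝ≥0, γ ω ≤ t → X t ω = Linf X ω)
    (T : Ω → ℝ≥0∞) (r : ℝ≥0∞) (hr : ∀ ω, T ω ⊓ γ ω = r ⊓ γ ω)
    (hU : UIMartingale μ γ (stopped X T)) :
    IntegrableOn (Linf X) (γ ⁻¹' {x | x ≤ r ∧ x ≠ ⊤}) μ := by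
  have hBm : MeasurableSet {x : ℝ≥0∞ | x ≤ r ∧ x ≠ ⊤} :=
    measurableSet_Iic.inter (measurableSet_singleton _).compl
  refine ⟨(measurable_Linf m X hXm).aestronglyMeasurable, ?_⟩
  obtain ⟨C, hC⟩ := hU.2.2.2
  set ν := μ.restrict (γ ⁻¹' {x | x ≤ r ∧ x ≠ ⊤}) with hν
  have hlim : ∀ᵐ ω ∂ν, ‖Linf X ω‖ₑ
      = liminf (fun k : ℕ => ‖stopped X T (k : ℝ≥0) ω‖ₑ) atTop := by
    filter_upwards [ae_restrict_of_ae hc, ae_restrict_mem (hγ hBm)] with ω h1 h2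
    symm
    apply Tendsto.liminf_eq
    apply tendsto_const_nhds.congr'
    filter_upwards [eventually_ge_atTop (⌈(γ ω).toNNReal⌉₊)] with k hk
    have hk' : γ ω ≤ (k : ℝ≥0) := by
      rw [← ENNReal.coe_toNNReal h2.2]
      exact_mod_cast Nat.ceil_le.1 hk
    have hne : ((k : ℝ≥0) : ℝ≥0∞) ⊓ T ω ≠ ⊤ := (lt_of_le_of_lt inf_le_left ENNReal.coe_lt_top).ne
    simp only [stopped]
    rw [h1]
    rw [ENNReal.coe_toNNReal hne]
    exact le_inf hk' ((le_iff_of_structure (hr ω)).2 h2.1)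
  have : ∫⁻ ω, ‖Linf X ω‖ₑ ∂ν ≤ C := by
    rw [lintegral_congr_ae hlim]
    refine (lintegral_liminf_le' ?_).trans ?_
    · intro k
      exact ((hU.2.1 (k : ℝ≥0)).mono_measure Measure.restrict_le_self).enorm
    · refine liminf_le_of_frequently_le' (Eventually.of_forall fun k => ?_).frequently
      refine (lintegral_mono' Measure.restrict_le_self le_rfl).trans ?_
      have := hC (k : ℝ≥0)
      rwa [eLpNorm_one_eq_lintegral_enorm] at this
  exact lt_of_le_of_lt this ENNReal.coe_lt_top

theorem ae_zero_of_Iic (μ : Measure Ω) [IsProbabilityMeasure μ] (γ : Ω → ℝ≥0∞)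
    (hγ : Measurable γ) (G G' : Ω → ℝ) (hG : Integrable G μ) (hGG' : G =ᵐ[μ] G')
    (hG' : Measurable[MeasurableSpace.comap γ inferInstance] G')
    (hz : ∀ x : ℝ≥0∞, ∫ ω in γ ⁻¹' (Iic x), G ω ∂μ = 0) : G =ᵐ[μ] 0 := by
  have htot : ∫ ω, G ω ∂μ = 0 := by
    have := hz ⊤
    simpa using this
  have hall : ∀ S : Set ℝ≥0∞, MeasurableSet S → ∫ ω in γ ⁻¹' S, G ω ∂μ = 0 := by
    intro S hS
    induction S, hS using MeasurableSpace.induction_on_inter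
      ((BorelSpace.measurable_eq (α := ℝ≥0∞)).trans (borel_eq_generateFrom_Iic ℝ≥0∞))
      isPiSystem_Iic with
    | empty => simp
    | basic t ht =>
      obtain ⟨x, rfl⟩ := ht
      exact hz x
    | compl t ht ih =>
      have := integral_add_compl (hγ ht) hG
      rw [ih, htot, zero_add] at this
      exact this
    | iUnion f hd hfm ih =>
      rw [Set.preimage_iUnion]
      have := hasSum_integral_iUnion (μ := μ) (f := G) (s := fun i => γ ⁻¹' (f i))
        (fun i => hγ (hfm i)) (fun i j hij => (hd hij).preimage γ) hG.integrableOn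
      simp only [ih] at this
      exact this.unique hasSum_zero
  have hce : (0 : Ω → ℝ) =ᵐ[μ] μ[G'|MeasurableSpace.comap γ inferInstance] := by
    refine ae_eq_condExp_of_forall_setIntegral_eq hγ.comap_le (hG.congr hGG')
      (fun _ _ _ => integrableOn_zero) ?_ aestronglyMeasurable_zero
    rintro _ ⟨S, hS, rfl⟩ _
    rw [← integral_congr_ae (ae_restrict_of_ae hGG'), hall S hS]
    simp
  rw [condExp_of_stronglyMeasurable hγ.comap_le hG'.stronglyMeasurable (hG.congr hGG')] at hce
  exact hGG'.trans hce.symm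

theorem cadlag_jump (g : ℝ≥0∞) (v : ℝ) : Cadlag fun t : ℝ≥0 => if g ≤ t then v else 0 := by
  constructor
  · intro t
    by_cases h : g ≤ t
    · refine (continuousWithinAt_const (b := v)).congr ?_ (if_pos h)
      intro s hs
      exact if_pos (h.trans (by exact_mod_cast hs))
    · refine ContinuousAt.continuousWithinAt ?_
      refine (continuousAt_const (y := (0 : ℝ))).congr ?_
      have h' : (t : ℝ≥0∞) < g := not_le.1 h
      filter_upwards [(ENNReal.continuous_coe.tendsto t).eventually (gt_mem_nhds h')] with s hs
      exact (if_neg (not_le.2 hs)).symm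
  · intro t _
    by_cases h : g < t
    · refine ⟨v, tendsto_const_nhds.congr' ?_⟩
      apply mem_nhdsWithin_of_mem_nhds
      filter_upwards [(ENNReal.continuous_coe.tendsto t).eventually (lt_mem_nhds h)] with s hs
      exact (if_pos hs.le).symm
    · refine ⟨0, tendsto_const_nhds.congr' ?_⟩
      filter_upwards [self_mem_nhdsWithin] with s hs
      refine (if_neg (not_le.2 (lt_of_lt_of_le ?_ (not_lt.1 h)))).symm
      exact_mod_cast hs

theorem Cadlag.sub {f g : ℝ≥0 → ℝ} (hf : Cadlag f) (hg : Cadlag g) :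
    Cadlag fun t => f t - g t := by
  refine ⟨fun t => (hf.1 t).sub (hg.1 t), fun t ht => ?_⟩
  obtain ⟨a, ha⟩ := hf.2 t ht
  obtain ⟨b, hb⟩ := hg.2 t ht
  exact ⟨a - b, ha.sub hb⟩

theorem setIntegral_Linf_zero (μ : Measure Ω) [IsProbabilityMeasure μ] (γ : Ω → ℝ≥0∞)
    (hγ : Measurable γ) (X : ℝ≥0 → Ω → ℝ)
    (hc : ∀ᵐ ω ∂μ, ∀ t : ℝ≥0, γ ω ≤ t → X t ω = Linf X ω)
    (hv : ∀ᵐ ω ∂μ, ∀ t : ℝ≥0, (t : ℝ≥0∞) < γ ω → X t ω = 0)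
    (h0 : ∫ ω, X 0 ω ∂μ = 0)
    (T : Ω → ℝ≥0∞) (r : ℝ≥0∞) (hr : ∀ ω, T ω ⊓ γ ω = r ⊓ γ ω)
    (hU : UIMartingale μ γ (stopped X T)) (t : ℝ≥0) (ht : (t : ℝ≥0∞) ≤ r) :
    ∫ ω in γ ⁻¹' (Iic (t : ℝ≥0∞)), Linf X ω ∂μ = 0 := by
  have h1 : stopped X T t =ᵐ[μ] (γ ⁻¹' (Iic (t : ℝ≥0∞))).indicator (Linf X) := by
    filter_upwards [hc, hv] with ω h1 h2
    have hne : (t : ℝ≥0∞) ⊓ T ω ≠ ⊤ := (lt_of_le_of_lt inf_le_left ENNReal.coe_lt_top).ne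
    by_cases h : γ ω ≤ t
    · rw [Set.indicator_of_mem (by exact h)]
      simp only [stopped]
      apply h1
      rw [ENNReal.coe_toNNReal hne]
      exact le_inf h ((le_iff_of_structure (hr ω)).2 (h.trans ht))
    · rw [Set.indicator_of_notMem (by exact h)]
      simp only [stopped]
      apply h2
      rw [ENNReal.coe_toNNReal hne]
      exact lt_of_le_of_lt inf_le_left (not_le.1 h)
  rw [← integral_indicator (hγ measurableSet_Iic), ← integral_congr_ae h1]
  have h2 := hU.1.2.2 0 trivial t trivial zero_le
  rw [← integral_condExp (jumpσ_le m γ 0), integral_congr_ae h2]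
  simpa [stopped] using h0

theorem ae_le_r (μ : Measure Ω) (γ : Ω → ℝ≥0∞) (T : ℕ → Ω → ℝ≥0∞) (r : ℕ → ℝ≥0∞)
    (hr : ∀ n ω, T n ω ⊓ γ ω = r n ⊓ γ ω)
    (hT : ∀ᵐ ω ∂μ, Monotone (fun n => T n ω) ∧
      Tendsto (fun n => T n ω) atTop (𝓝 (⊤ : ℝ≥0∞))) :
    ∀ᵐ ω ∂μ, γ ω ≠ ⊤ → ∃ n, γ ω ≤ r n := by
  filter_upwards [hT] with ω h hne
  obtain ⟨n, hn⟩ := (h.2.eventually (lt_mem_nhds (lt_top_iff_ne_top.2 hne))).exists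
  exact ⟨n, (le_iff_of_structure (hr n ω)).1 hn.le⟩

theorem uniq_aux (μ : Measure Ω) [IsProbabilityMeasure μ] (γ : Ω → ℝ≥0∞)
    (hγ : Measurable γ) (M X' X'' Y' Y'' : ℝ≥0 → Ω → ℝ)
    (hX' : LocalMartingale μ γ X') (hX'' : LocalMartingale μ γ X'')
    (hXm : ∀ t : ℝ≥0, Measurable[jumpσ (MeasurableSpace.comap γ inferInstance) γ t] (X' t))
    (hXv : ∀ᵐ ω ∂μ, ∀ t : ℝ≥0, (t : ℝ≥0∞) < γ ω → X'' t ω = 0)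
    (hX0 : ∫ ω, X'' 0 ω ∂μ = 0)
    (hXs : ∀ᵐ ω ∂μ, ∀ t : ℝ≥0, M t ω = X' t ω + X'' t ω)
    (hY' : LocalMartingale μ γ Y') (hY'' : LocalMartingale μ γ Y'')
    (hYm : ∀ t : ℝ≥0, Measurable[jumpσ (MeasurableSpace.comap γ inferInstance) γ t] (Y' t))
    (hYv : ∀ᵐ ω ∂μ, ∀ t : ℝ≥0, (t : ℝ≥0∞) < γ ω → Y'' t ω = 0)
    (hY0 : ∫ ω, Y'' 0 ω ∂μ = 0)
    (hYs : ∀ᵐ ω ∂μ, ∀ t : ℝ≥0, M t ω = Y' t ω + Y'' t ω) :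
    ∀ᵐ ω ∂μ, ∀ t : ℝ≥0, Y' t ω = X' t ω ∧ Y'' t ω = X'' t ω := by
  have cX' := const_after μ γ hγ X' hX'
  have cX := const_after μ γ hγ X'' hX''
  have cY' := const_after μ γ hγ Y' hY'
  have cY := const_after μ γ hγ Y'' hY''
  obtain ⟨hXa, -, T, hT, hTlim, hXU⟩ := hX''
  obtain ⟨hYa, -, S, hS, hSlim, hYU⟩ := hY''
  choose r hr using fun n => stopping_structure γ (T n) (hT n)
  choose q hq using fun n => stopping_structure γ (S n) (hS n)
  have mX' : Measurable[MeasurableSpace.comap γ inferInstance] (Linf X') :=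
    measurable_Linf _ X' fun t => (hXm t).mono (jumpσ_le _ γ t) le_rfl
  have mY' : Measurable[MeasurableSpace.comap γ inferInstance] (Linf Y') :=
    measurable_Linf _ Y' fun t => (hYm t).mono (jumpσ_le _ γ t) le_rfl
  have hrel : ∀ᵐ ω ∂μ, γ ω ≠ ⊤ → Linf X'' ω - Linf Y'' ω = Linf Y' ω - Linf X' ω := by
    filter_upwards [cX', cX, cY', cY, hXs, hYs] with ω a b c d e f hne
    have hle : γ ω ≤ ((γ ω).toNNReal : ℝ≥0∞) := (ENNReal.coe_toNNReal hne).ge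
    have e1 := e (γ ω).toNNReal
    have f1 := f (γ ω).toNNReal
    rw [a _ hle, b _ hle] at e1
    rw [c _ hle, d _ hle] at f1
    linarith
  have main : ∀ i j k : ℕ, ∀ᵐ ω ∂μ, γ ω ≤ r i → γ ω ≤ q j → γ ω ≤ (k : ℝ≥0) →
      Linf X'' ω = Linf Y'' ω := by
    intro i j k
    set ρ : ℝ≥0∞ := r i ⊓ q j ⊓ (k : ℝ≥0) with hρ
    have hρr : ρ ≤ r i := inf_le_left.trans inf_le_left
    have hρq : ρ ≤ q j := inf_le_left.trans inf_le_right
    have hρt : ρ < ⊤ := lt_of_le_of_lt inf_le_right ENNReal.coe_lt_top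
    have iX : IntegrableOn (Linf X'') (γ ⁻¹' Iic ρ) μ :=
      (integrableOn_Linf μ γ hγ X'' (fun t => (hXa t).mono (jumpσ_le _ γ t) le_rfl) cX (T i) (r i)
        (hr i) (hXU i)).mono_set (Set.preimage_mono fun x hx =>
          ⟨le_trans hx hρr, (lt_of_le_of_lt hx hρt).ne⟩)
    have iY : IntegrableOn (Linf Y'') (γ ⁻¹' Iic ρ) μ :=
      (integrableOn_Linf μ γ hγ Y'' (fun t => (hYa t).mono (jumpσ_le _ γ t) le_rfl) cY (S j) (q j)
        (hq j) (hYU j)).mono_set (Set.preimage_mono fun x hx =>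
          ⟨le_trans hx hρq, (lt_of_le_of_lt hx hρt).ne⟩)
    have hBc : MeasurableSet[MeasurableSpace.comap γ inferInstance] (γ ⁻¹' Iic ρ) :=
      ⟨_, measurableSet_Iic, rfl⟩
    have hB : MeasurableSet (γ ⁻¹' Iic ρ) := hγ measurableSet_Iic
    have key := ae_zero_of_Iic μ γ hγ
      ((γ ⁻¹' Iic ρ).indicator (fun ω => Linf X'' ω - Linf Y'' ω))
      ((γ ⁻¹' Iic ρ).indicator (fun ω => Linf Y' ω - Linf X' ω))
      ((integrable_indicator_iff hB).2 (iX.sub iY))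
      (by
        filter_upwards [hrel] with ω hω
        by_cases h : γ ω ≤ ρ
        · rw [Set.indicator_of_mem (by exact h), Set.indicator_of_mem (by exact h)]
          exact hω (lt_of_le_of_lt h hρt).ne
        · rw [Set.indicator_of_notMem (by exact h), Set.indicator_of_notMem (by exact h)])
      ((mY'.sub mX').indicator hBc)
      (by
        intro x
        rw [setIntegral_indicator hB, ← Set.preimage_inter, Set.Iic_inter_Iic]
        have hlt : x ⊓ ρ < ⊤ := lt_of_le_of_lt inf_le_right hρt
        have hco := ENNReal.coe_toNNReal hlt.ne
        have hsub : γ ⁻¹' Iic (x ⊓ ρ) ⊆ γ ⁻¹' Iic ρ :=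
          Set.preimage_mono (Set.Iic_subset_Iic.2 inf_le_right)
        rw [integral_sub (iX.mono_set hsub) (iY.mono_set hsub), ← hco,
          setIntegral_Linf_zero μ γ hγ X'' cX hXv hX0 (T i) (r i) (hr i) (hXU i) _
            (by rw [hco]; exact inf_le_right.trans hρr),
          setIntegral_Linf_zero μ γ hγ Y'' cY hYv hY0 (S j) (q j) (hq j) (hYU j) _
            (by rw [hco]; exact inf_le_right.trans hρq), sub_zero])
    filter_upwards [key] with ω hω h1 h2 h3
    rw [Set.indicator_of_mem (by exact le_inf (le_inf h1 h2) h3)] at hω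
    simpa [sub_eq_zero] using hω
  have main' : ∀ᵐ ω ∂μ, ∀ i j k : ℕ, γ ω ≤ r i → γ ω ≤ q j → γ ω ≤ (k : ℝ≥0) →
      Linf X'' ω = Linf Y'' ω :=
    ae_all_iff.2 fun i => ae_all_iff.2 fun j => ae_all_iff.2 fun k => main i j k
  filter_upwards [main', cX, cY, hXv, hYv, hXs, hYs, ae_le_r μ γ T r hr hTlim,
    ae_le_r μ γ S q hq hSlim] with ω h1 h2 h3 h4 h5 h6 h7 h8 h9 t
  have e : Y'' t ω = X'' t ω := by
    by_cases h : γ ω ≤ t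
    · have hne : γ ω ≠ ⊤ := (lt_of_le_of_lt h ENNReal.coe_lt_top).ne
      obtain ⟨i, hi⟩ := h8 hne
      obtain ⟨j, hj⟩ := h9 hne
      rw [h2 t h, h3 t h]
      refine (h1 i j ⌈t⌉₊ hi hj (h.trans ?_)).symm
      exact_mod_cast Nat.le_ceil t
    · rw [h4 t (not_le.1 h), h5 t (not_le.1 h)]
  refine ⟨?_, e⟩
  have a := h6 t
  have b := h7 t
  linarith

/-- **Corollary 1.** Every local martingale `M` has a unique (up to indistinguishability)
decomposition `M = M' + M''` into two local martingales, where `M'` is adapted w.r.t. the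
single jump filtration `𝔽(γ, σ{γ})` generated by `γ` and `σ{γ}`, and `M''` vanishes on
`{t < γ}` and satisfies `E(M''_0) = 0`. -/
theorem stmt_10 (μ : Measure Ω) [IsProbabilityMeasure μ] (γ : Ω → ℝ≥0∞)
    (hγ : Measurable γ) (hpos : 0 < μ {ω | 0 < γ ω})
    (M : ℝ≥0 → Ω → ℝ) (hM : LocalMartingale μ γ M) :
    ∃ M' M'' : ℝ≥0 → Ω → ℝ,
      (LocalMartingale μ γ M' ∧ LocalMartingale μ γ M'' ∧
        (∀ t : ℝ≥0,
          Measurable[jumpσ (MeasurableSpace.comap γ inferInstance) γ t] (M' t)) ∧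
        (∀ᵐ ω ∂μ, ∀ t : ℝ≥0, (t : ℝ≥0∞) < γ ω → M'' t ω = 0) ∧
        (∫ ω, M'' 0 ω ∂μ = 0) ∧
        (∀ᵐ ω ∂μ, ∀ t : ℝ≥0, M t ω = M' t ω + M'' t ω)) ∧
      (∀ N' N'' : ℝ≥0 → Ω → ℝ,
        (LocalMartingale μ γ N' ∧ LocalMartingale μ γ N'' ∧
          (∀ t : ℝ≥0,
            Measurable[jumpσ (MeasurableSpace.comap γ inferInstance) γ t] (N' t)) ∧
          (∀ᵐ ω ∂μ, ∀ t : ℝ≥0, (t : ℝ≥0∞) < γ ω → N'' t ω = 0) ∧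
          (∫ ω, N'' 0 ω ∂μ = 0) ∧
          (∀ᵐ ω ∂μ, ∀ t : ℝ≥0, M t ω = N' t ω + N'' t ω)) →
        (∀ᵐ ω ∂μ, ∀ t : ℝ≥0, N' t ω = M' t ω ∧ N'' t ω = M'' t ω)) := by
  have hc := const_after μ γ hγ M hM
  obtain ⟨hMa, hMc, T, hT, hTlim, hMU⟩ := hM
  choose r hr using fun n => stopping_structure γ (T n) (hT n)
  obtain ⟨F, hF⟩ := exists_const m γ M hMa
  have hMm : ∀ t, Measurable (M t) := fun t => (hMa t).mono (jumpσ_le _ γ t) le_rfl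
  have hL : Measurable (Linf M) := measurable_Linf m M hMm
  obtain ⟨h, hh, hcond⟩ := exists_condGamma μ γ hγ (Linf M) hL
  set V : Ω → ℝ := fun ω => Linf M ω - h (γ ω) with hV
  have hVm : Measurable V := hL.sub (hh.comp hγ)
  have hVint : ∀ S : Set ℝ≥0∞, MeasurableSet S → IntegrableOn (Linf M) (γ ⁻¹' S) μ →
      IntegrableOn V (γ ⁻¹' S) μ ∧ ∫ ω in γ ⁻¹' S, V ω ∂μ = 0 := by
    intro S hS hi
    obtain ⟨h1, h2⟩ := hcond S hS hi
    refine ⟨hi.sub h1, ?_⟩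
    simp only [hV]
    rw [integral_sub hi h1, h2, sub_self]
  let M1 : ℝ≥0 → Ω → ℝ := fun t ω => if γ ω ≤ t then h (γ ω) else F t
  let M2 : ℝ≥0 → Ω → ℝ := fun t ω => if γ ω ≤ t then V ω else 0
  have hBm : ∀ r : ℝ≥0∞, MeasurableSet {x : ℝ≥0∞ | x ≤ r ∧ x ≠ ⊤} := fun r =>
    measurableSet_Iic.inter (measurableSet_singleton _).compl
  have hMi : ∀ n, IntegrableOn (Linf M) (γ ⁻¹' {x | x ≤ r n ∧ x ≠ ⊤}) μ := fun n =>
    integrableOn_Linf μ γ hγ M hMm hc (T n) (r n) (hr n) (hMU n)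
  have hsum : ∀ᵐ ω ∂μ, ∀ t : ℝ≥0, M t ω = M1 t ω + M2 t ω := by
    filter_upwards [hc] with ω hω t
    by_cases h1 : γ ω ≤ t
    · simp only [M1, M2, if_pos h1, hω t h1, hV]
      ring
    · simp only [M1, M2, if_neg h1, hF t ω (not_le.1 h1), add_zero]
  have hM2U : ∀ n, UIMartingale μ γ (stopped M2 (T n)) := by
    intro n
    refine uiMartingale_jump μ γ hγ V hVm (T n) (r n) (hr n) (hVint _ (hBm _) (hMi n)).1 ?_
    intro S hS hsub
    exact (hVint S hS ((hMi n).mono_set (Set.preimage_mono hsub))).2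
  have hM2cad : ∀ ω, Cadlag fun t => M2 t ω := fun ω => cadlag_jump (γ ω) (V ω)
  have hM2 : LocalMartingale μ γ M2 := by
    refine ⟨fun t => ?_, Eventually.of_forall hM2cad, T, hT, hTlim, hM2U⟩
    refine measurable_jumpσ_of m γ t _ ?_ 0 fun ω hω => if_neg (not_le.2 hω)
    exact Measurable.ite (measurableSet_le hγ measurable_const) hVm measurable_const
  have hγc : Measurable[MeasurableSpace.comap γ inferInstance] γ := comap_measurable γ
  have hM1m : ∀ t : ℝ≥0,
      Measurable[jumpσ (MeasurableSpace.comap γ inferInstance) γ t] (M1 t) := by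
    intro t
    refine measurable_jumpσ_of _ γ t _ ?_ (F t) fun ω hω => if_neg (not_le.2 hω)
    exact Measurable.ite (hγc measurableSet_Iic) (hh.comp hγc) measurable_const
  have hM1 : LocalMartingale μ γ M1 := by
    refine ⟨fun t => (hM1m t).mono (jumpσ_mono_left hγ.comap_le γ t) le_rfl, ?_, T, hT, hTlim, ?_⟩
    · filter_upwards [hMc, hsum] with ω h1 h2
      have : (fun t => M1 t ω) = fun t => M t ω - M2 t ω := by
        ext t
        rw [h2 t]; ring
      rw [this]
      exact h1.sub (hM2cad ω)
    · intro n
      refine uiMartingale_sub μ γ (stopped M (T n)) (stopped M2 (T n)) _ (hMU n) (hM2U n) ?_ ?_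
      · intro t
        have hne : (t : ℝ≥0∞) ⊓ r n ≠ ⊤ := (lt_of_le_of_lt inf_le_left ENNReal.coe_lt_top).ne
        have e : stopped M1 (T n) t = fun ω => if γ ω ≤ (t : ℝ≥0∞) ⊓ r n then h (γ ω)
            else F (((t : ℝ≥0∞) ⊓ r n).toNNReal) := by
          ext ω
          have hne' : (t : ℝ≥0∞) ⊓ T n ω ≠ ⊤ :=
            (lt_of_le_of_lt inf_le_left ENNReal.coe_lt_top).ne
          simp only [stopped, M1, ENNReal.coe_toNNReal hne']
          by_cases h1 : γ ω ≤ (t : ℝ≥0∞) ⊓ r n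
          · have h2 : γ ω ≤ (t : ℝ≥0∞) ⊓ T n ω :=
              le_inf (h1.trans inf_le_left)
                ((le_iff_of_structure (hr n ω)).2 (h1.trans inf_le_right))
            rw [if_pos h1, if_pos h2]
          · rw [inf_eq_of_structure (hr n ω) (not_le.1 h1)]
        rw [e]
        refine measurable_jumpσ_of m γ t _ ?_ (F (((t : ℝ≥0∞) ⊓ r n).toNNReal)) ?_
        · exact Measurable.ite (measurableSet_le hγ measurable_const) (hh.comp hγ) measurable_const
        · intro ω hω
          exact if_neg (not_le.2 (lt_of_le_of_lt inf_le_left hω))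
      · intro t
        filter_upwards [hsum] with ω hω
        simp only [stopped, Pi.sub_apply]
        rw [hω]; ring
  have hM2v : ∀ᵐ ω ∂μ, ∀ t : ℝ≥0, (t : ℝ≥0∞) < γ ω → M2 t ω = 0 :=
    Eventually.of_forall fun ω t hω => if_neg (not_le.2 hω)
  have hM20 : ∫ ω, M2 0 ω ∂μ = 0 := by
    have hi0 : IntegrableOn (Linf M) (γ ⁻¹' {0}) μ := by
      have h1 : Integrable (M 0) μ := by
        have := (hMU 0).1.2.1 0 trivial
        have e : stopped M (T 0) 0 = M 0 := by
          ext ω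
          simp [stopped]
        rwa [e] at this
      refine (h1.integrableOn (s := γ ⁻¹' {0})).congr ?_
      filter_upwards [ae_restrict_of_ae hc, ae_restrict_mem (hγ (measurableSet_singleton 0))]
        with ω h1 h2
      exact h1 0 (le_of_eq h2)
    have h2 := (hVint {0} (measurableSet_singleton 0) hi0).2
    rw [← integral_indicator (hγ (measurableSet_singleton 0))] at h2
    rw [← h2]
    congr 1
    ext ω
    simp [M2, Set.indicator]
  refine ⟨M1, M2, ⟨hM1, hM2, hM1m, hM2v, hM20, hsum⟩, ?_⟩
  rintro N' N'' ⟨a, b, c, d, e, f⟩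
  exact uniq_aux μ γ hγ M M1 M2 N' N'' hM1 hM2 hM1m hM2v hM20 hsum a b c d e f

end WithMeasurableSpace

end SingleJump
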